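/- arXiv:1310.8373 — 2 statements merged into one kernel-verified Lean document; each statement's English description precedes it below -/
import Mathlib

section
/- Let X and Y be metric spaces, let n be a natural number, and let f : X → Y be a surjective 1-Lipschitz map. Denote by μ the n-dimensional Hausdorff measure (on X and on Y respectively). If μ(X) = μ(Y) < ∞, then for every Borel set A ⊆ Y one has μ(f⁻¹(A)) = μ(A). -/
open MeasureTheory

/-- If `f : X → Y` is a surjective `1`-Lipschitz map between metric spaces with
equal finite `n`-dimensional Hausdorff measure, then `f` preserves the
`n`-dimensional Hausdorff measure of every Borel set `A ⊆ Y`: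
`μH[n] (f ⁻¹' A) = μH[n] A`. -/
theorem hausdorffMeasure_preimage_of_volume_eq {X Y : Type*}
    [MetricSpace X] [MeasurableSpace X] [BorelSpace X]
    [MetricSpace Y] [MeasurableSpace Y] [BorelSpace Y]
    (n : ℕ) (f : X → Y) (hf_surj : Function.Surjective f) (hf_lip : LipschitzWith 1 f)
    (h_eq : μH[(n : ℝ)] (Set.univ : Set X) = μH[(n : ℝ)] (Set.univ : Set Y))
    (h_fin : μH[(n : ℝ)] (Set.univ : Set Y) < ⊤) :
    ∀ A : Set Y, MeasurableSet A → μH[(n : ℝ)] (f ⁻¹' A) = μH[(n : ℝ)] A := by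
  have hf := hf_lip.continuous.measurable
  have : IsFiniteMeasure (μH[(n : ℝ)] : Measure Y) := ⟨h_fin⟩
  have hle : (μH[(n : ℝ)] : Measure Y) ≤ Measure.map f μH[(n : ℝ)] := by
    refine Measure.le_iff.2 fun s hs ↦ ?_
    rw [Measure.map_apply hf hs]
    simpa [Set.image_preimage_eq s hf_surj] using
      hf_lip.hausdorffMeasure_image_le n.cast_nonneg (f ⁻¹' s)
  have heq := Measure.eq_of_le_of_measure_univ_eq hle
    (by rw [Measure.map_apply hf .univ, Set.preimage_univ, h_eq])
  intro A hA
  rw [← Measure.map_apply hf hA, ← heq]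
end

section
/- Let n ≥ 1 be a natural number, r > 0, and let x₁, x₂ ∈ ℝⁿ with d := |x₁ − x₂| ≤ 2r. Set θ = arccos(d/(2r)) ∈ [0, π/2]. Then the n-dimensional Lebesgue volume of the union of the two balls of radius r satisfies vol_n(B_r(x₁) ∪ B_r(x₂)) = vol_n(B_rⁿ(0)) + 2r · vol_{n−1}(B_r^{n−1}(0)) · ∫_θ^{π/2} sinⁿ(t) dt, where vol_{n−1}(B_r^{n−1}(0)) is the (n−1)-dimensional Lebesgue volume of the radius-r ball in ℝ^{n−1} (interpreted as 1 when n = 1). -/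
open MeasureTheory Real

theorem ball_union_ball_measure_eq_add_slab {E : Type*} [NormedAddCommGroup E] [InnerProductSpace ℝ E]
    [MeasurableSpace E] [BorelSpace E] (μ : Measure E) [μ.IsAddHaarMeasure] (r : ℝ) (x₁ x₂ : E) :
    μ (Metric.ball x₁ r ∪ Metric.ball x₂ r) = μ (Metric.ball 0 r) +
      μ (Metric.ball 0 r ∩ {y | inner ℝ (x₂ - x₁) y ∈
        Set.Ico (-(‖x₂ - x₁‖ ^ 2 / 2)) (‖x₂ - x₁‖ ^ 2 / 2)}) := by
  set v := x₂ - x₁ with hv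
  set h := ‖v‖ ^ 2 / 2 with hh
  have h0 : 0 ≤ h := by positivity
  have hx₂ : x₂ = x₁ + v := by simp [hv]
  have hc : Continuous fun y : E => inner ℝ v y := by fun_prop
  have hsplit : Metric.ball x₁ r ∪ Metric.ball x₂ r =
      (fun x => -x₁ + x) ⁻¹' (Metric.ball 0 r ∩ {y | inner ℝ v y < h}) ∪
      (fun x => -x₂ + x) ⁻¹' (Metric.ball 0 r ∩ {y | -h ≤ inner ℝ v y}) := by
    ext x
    obtain ⟨y, rfl⟩ : ∃ y, x = x₁ + y := ⟨x - x₁, by abel⟩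
    have e2 : -x₂ + (x₁ + y) = y - v := by rw [hx₂]; abel
    have e3 : x₁ + y - x₂ = y - v := by rw [hx₂]; abel
    have key : ‖y - v‖ ^ 2 = ‖y‖ ^ 2 - 2 * inner ℝ v y + 2 * h := by
      rw [norm_sub_sq_real, real_inner_comm, hh]; ring
    simp only [Set.mem_union, Metric.mem_ball, dist_eq_norm, Set.mem_preimage, Set.mem_inter_iff,
      Set.mem_ofPred_eq, e2, e3, sub_zero, add_sub_cancel_left, neg_add_cancel_left,
      inner_sub_right, real_inner_self_eq_norm_sq]
    have hv2 : ‖v‖ ^ 2 = 2 * h := by rw [hh]; ring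
    rw [hv2]
    rcases lt_or_ge (inner ℝ v y) h with hlt | hge
    · have : ‖y‖ ≤ ‖y - v‖ := by
        exact (sq_le_sq₀ (norm_nonneg _) (norm_nonneg _)).1 (by linarith)
      grind
    · have : ‖y - v‖ ≤ ‖y‖ := by
        exact (sq_le_sq₀ (norm_nonneg _) (norm_nonneg _)).1 (by linarith)
      grind
  have hm₁ : MeasurableSet (Metric.ball (0 : E) r ∩ {y | inner ℝ v y < h}) :=
    Metric.isOpen_ball.measurableSet.inter (isOpen_lt hc continuous_const).measurableSet
  have hm₂ : MeasurableSet (Metric.ball (0 : E) r ∩ {y | -h ≤ inner ℝ v y}) :=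
    Metric.isOpen_ball.measurableSet.inter (isClosed_le continuous_const hc).measurableSet
  rw [hsplit, measure_union _ (measurable_const_add (-x₂) hm₂),
    measure_preimage_add, measure_preimage_add, ← measure_union_add_inter _ hm₂]
  · congr 2
    · ext y; simp only [Set.mem_union, Set.mem_inter_iff, Set.mem_ofPred_eq]; grind
    · ext y; simp only [Set.mem_Ico, Set.mem_inter_iff, Set.mem_ofPred_eq]; grind
  · rw [Set.disjoint_left]
    rintro x ⟨-, h1⟩ ⟨-, h2⟩
    have e2 : -x₂ + x = (-x₁ + x) - v := by rw [hx₂]; abel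
    simp only [Set.mem_ofPred_eq, e2, inner_sub_right, real_inner_self_eq_norm_sq] at h1 h2
    linarith

theorem EuclideanSpace.exists_linearIsometryEquiv_apply_eq {E : Type*} [NormedAddCommGroup E]
    [InnerProductSpace ℝ E] {m : ℕ} (hE : Module.finrank ℝ E = m + 1) {v : E} (hv : v ≠ 0) :
    ∃ e : E ≃ₗᵢ[ℝ] EuclideanSpace ℝ (Fin (m + 1)), ∀ y, inner ℝ v y = ‖v‖ * e y 0 := by
  have : FiniteDimensional ℝ E := .of_finrank_pos (by omega)
  have hn : ‖v‖ ≠ 0 := norm_ne_zero_iff.mpr hv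
  obtain ⟨b, hb⟩ := Orthonormal.exists_orthonormalBasis_extension_of_card_eq (𝕜 := ℝ)
    (ι := Fin (m + 1)) (by simp [hE]) (v := fun _ => ‖v‖⁻¹ • v) (s := {0})
    (by
      rw [orthonormal_iff_ite]
      rintro ⟨i, rfl⟩ ⟨j, rfl⟩
      simp only [Set.domRestrict_apply, inner_smul_left, inner_smul_right,
        real_inner_self_eq_norm_sq]
      simp; field_simp)
  refine ⟨b.repr, fun y => ?_⟩
  rw [b.repr_apply_apply, hb 0 rfl, inner_smul_left]
  simp
  field_simp

theorem EuclideanSpace.volume_ball_inter_slab {m : ℕ} {r : ℝ} (hr : 0 < r) {s : Set ℝ}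
    (hs : MeasurableSet s) :
    volume (Metric.ball (0 : EuclideanSpace ℝ (Fin (m + 1))) r ∩ {y | y 0 ∈ s}) =
      ∫⁻ t in s, volume (Metric.ball (0 : EuclideanSpace ℝ (Fin m)) √(r ^ 2 - t ^ 2)) := by
  have hmp := (volume_preserving_piFinSuccAbove (fun _ : Fin (m + 1) => ℝ) 0).symm
  have hmp' := (PiLp.volume_preserving_toLp (Fin (m + 1))).comp hmp
  have hms : MeasurableSet
      (Metric.ball (0 : EuclideanSpace ℝ (Fin (m + 1))) r ∩ {y | y 0 ∈ s}) :=
    Metric.isOpen_ball.measurableSet.inter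
      ((by fun_prop : Measurable fun y : EuclideanSpace ℝ (Fin (m + 1)) => y 0) hs)
  rw [← hmp'.measure_preimage hms.nullMeasurableSet, Measure.volume_eq_prod,
    Measure.prod_apply (hmp'.measurable hms), ← lintegral_indicator hs]
  congr 1
  ext t
  by_cases ht : t ∈ s
  · rw [Set.indicator_of_mem ht, ← (PiLp.volume_preserving_toLp (Fin m)).measure_preimage
      Metric.isOpen_ball.measurableSet.nullMeasurableSet]
    congr 1
    ext y
    simp [MeasurableEquiv.piFinSuccAbove, ht, EuclideanSpace.norm_eq, Fin.sum_univ_succ]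
    rw [Real.sqrt_lt' hr, Real.sqrt_lt_sqrt_iff (by positivity), lt_sub_iff_add_lt']
  · rw [Set.indicator_of_notMem ht]
    convert measure_empty (μ := volume)
    ext y
    simp [MeasurableEquiv.piFinSuccAbove, ht]

theorem integral_sqrt_sq_sub_sq_pow {r c : ℝ} (hr : 0 < r) (hc : 0 ≤ c) (hcr : c ≤ r) (m : ℕ) :
    ∫ t in (-c)..c, √(r ^ 2 - t ^ 2) ^ m =
      2 * r ^ (m + 1) * ∫ t in arccos (c / r)..(π / 2), sin t ^ (m + 1) := by
  set θ := arccos (c / r) with hθ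
  have hcos : r * cos θ = c := by
    rw [hθ, cos_arccos]
    · field_simp
    · linarith [div_nonneg hc hr.le]
    · exact (div_le_one hr).2 hcr
  have hθ0 : 0 ≤ θ := arccos_nonneg _
  have hθ1 : θ ≤ π / 2 := arccos_le_pi_div_two.2 (div_nonneg hc hr.le)
  have hsub := intervalIntegral.integral_comp_mul_deriv (a := θ) (b := π - θ)
    (f := fun t => -(r * cos t)) (f' := fun t => r * sin t)
    (g := fun t => √(r ^ 2 - t ^ 2) ^ m)
    (fun t _ => ((hasDerivAt_cos t).const_mul r).fun_neg.congr_deriv (by ring))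
    (by fun_prop) (by fun_prop)
  simp only [cos_pi_sub, mul_neg, neg_neg, hcos] at hsub
  rw [← hsub]
  have hcongr : ∫ t in θ..(π - θ),
      ((fun t => √(r ^ 2 - t ^ 2) ^ m) ∘ fun t => -(r * cos t)) t * (r * sin t) =
      ∫ t in θ..(π - θ), r ^ (m + 1) * sin t ^ (m + 1) := by
    refine intervalIntegral.integral_congr fun t ht => ?_
    rw [Set.uIcc_of_le (by linarith)] at ht
    have hsin : 0 ≤ sin t := sin_nonneg_of_nonneg_of_le_pi (by linarith [ht.1]) (by linarith [ht.2])
    have : r ^ 2 - (-(r * cos t)) ^ 2 = (r * sin t) ^ 2 := by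
      rw [mul_pow, sin_sq]; ring
    simp only [Function.comp, this, sqrt_sq (mul_nonneg hr.le hsin)]
    ring
  have hsymm : ∫ t in (π / 2)..(π - θ), sin t ^ (m + 1) =
      ∫ t in θ..(π / 2), sin t ^ (m + 1) := by
    have := intervalIntegral.integral_comp_sub_left (a := θ) (b := π / 2)
      (fun t => sin t ^ (m + 1)) π
    simp only [sin_pi_sub] at this
    rw [this]; congr 1; ring
  rw [hcongr, intervalIntegral.integral_const_mul,
    ← intervalIntegral.integral_add_adjacent_intervals (b := π / 2)
      ((by fun_prop : Continuous fun t => sin t ^ (m + 1)).intervalIntegrable _ _)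
      ((by fun_prop : Continuous fun t => sin t ^ (m + 1)).intervalIntegrable _ _), hsymm]
  ring

theorem EuclideanSpace.volume_ball_inter_slab_toReal {m : ℕ} {r c : ℝ} (hr : 0 < r) (hc : 0 ≤ c)
    (hcr : c ≤ r) :
    (volume (Metric.ball (0 : EuclideanSpace ℝ (Fin (m + 1))) r ∩
      {y | y 0 ∈ Set.Ico (-c) c})).toReal =
      2 * r * (volume (Metric.ball (0 : EuclideanSpace ℝ (Fin m)) r)).toReal *
        ∫ t in arccos (c / r)..(π / 2), sin t ^ (m + 1) := by
  have hball (ρ : ℝ) (hρ : 0 < ρ) : volume (Metric.ball (0 : EuclideanSpace ℝ (Fin m)) ρ) =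
      ENNReal.ofReal (ρ ^ m) * volume (Metric.ball (0 : EuclideanSpace ℝ (Fin m)) 1) := by
    simpa using Measure.addHaar_ball_of_pos volume (0 : EuclideanSpace ℝ (Fin m)) hρ
  have hint : ∫⁻ t in Set.Ico (-c) c, ENNReal.ofReal (√(r ^ 2 - t ^ 2) ^ m) =
      ENNReal.ofReal (∫ t in (-c)..c, √(r ^ 2 - t ^ 2) ^ m) := by
    rw [intervalIntegral.integral_of_le (by linarith), restrict_Ico_eq_restrict_Ioc,
      ofReal_integral_eq_lintegral_ofReal]
    · exact (by fun_prop : Continuous fun t : ℝ => √(r ^ 2 - t ^ 2) ^ m).integrableOn_Ioc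
    · exact .of_forall fun t => by positivity
  have hslice : ∫⁻ t in Set.Ico (-c) c,
        volume (Metric.ball (0 : EuclideanSpace ℝ (Fin m)) √(r ^ 2 - t ^ 2)) =
      ∫⁻ t in Set.Ico (-c) c, ENNReal.ofReal (√(r ^ 2 - t ^ 2) ^ m) *
        volume (Metric.ball (0 : EuclideanSpace ℝ (Fin m)) 1) := by
    rw [Measure.restrict_congr_set Ioo_ae_eq_Ico.symm]
    refine setLIntegral_congr_fun measurableSet_Ioo fun t ht => hball _ (sqrt_pos.2 ?_)
    nlinarith [ht.1, ht.2]
  rw [volume_ball_inter_slab hr measurableSet_Ico, hslice, lintegral_mul_const _ (by fun_prop),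
    hint, hball r hr, ENNReal.toReal_mul, ENNReal.toReal_mul, ENNReal.toReal_ofReal,
    ENNReal.toReal_ofReal (by positivity), integral_sqrt_sq_sub_sq_pow hr hc hcr]
  · ring
  · exact intervalIntegral.integral_nonneg (by linarith) fun t _ => by positivity

/-- Volume of the union of two balls of radius `r` in `ℝⁿ` whose centers are at
distance `d ≤ 2r`: with `θ = arccos (d / (2r))`,
`vol_n(B_r(x₁) ∪ B_r(x₂)) = vol_n(B_rⁿ(0)) + 2r · vol_{n-1}(B_r^{n-1}(0)) · ∫_θ^{π/2} sinⁿ t dt`. -/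
theorem volume_union_two_balls (n : ℕ) (hn : 1 ≤ n) (r : ℝ) (hr : 0 < r)
    (x₁ x₂ : EuclideanSpace ℝ (Fin n)) (hd : dist x₁ x₂ ≤ 2 * r) :
    (volume (Metric.ball x₁ r ∪ Metric.ball x₂ r)).toReal =
      (volume (Metric.ball (0 : EuclideanSpace ℝ (Fin n)) r)).toReal +
        2 * r * (volume (Metric.ball (0 : EuclideanSpace ℝ (Fin (n - 1))) r)).toReal *
          ∫ t in (Real.arccos (dist x₁ x₂ / (2 * r)))..(π / 2), (Real.sin t) ^ n := by
  obtain ⟨m, rfl⟩ : ∃ m, n = m + 1 := ⟨n - 1, by omega⟩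
  rw [ball_union_ball_measure_eq_add_slab, ENNReal.toReal_add measure_ball_lt_top.ne
    ((measure_mono Set.inter_subset_left).trans_lt measure_ball_lt_top).ne, Nat.add_sub_cancel]
  congr 1
  rw [dist_comm, dist_eq_norm] at *
  set v := x₂ - x₁
  rcases eq_or_ne v 0 with hv | hv
  · simp [hv]
  have hpos : 0 < ‖v‖ := norm_pos_iff.2 hv
  obtain ⟨e, he⟩ := EuclideanSpace.exists_linearIsometryEquiv_apply_eq (m := m) (by simp) hv
  rw [← div_div,
    ← EuclideanSpace.volume_ball_inter_slab_toReal hr (by positivity) (by linarith),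
    ← e.measurePreserving.measure_preimage_equiv (f := e.toMeasurableEquiv)
      (Metric.ball 0 r ∩ {y | y 0 ∈ _})]
  congr 2
  ext y
  simp only [Set.mem_inter_iff, Set.mem_preimage, Set.mem_ofPred_eq, Set.mem_Ico, he,
    mem_ball_zero_iff, LinearIsometryEquiv.coe_toMeasurableEquiv, e.norm_map]
  have h1 : -(‖v‖ ^ 2 / 2) = ‖v‖ * -(‖v‖ / 2) := by ring
  have h2 : ‖v‖ ^ 2 / 2 = ‖v‖ * (‖v‖ / 2) := by ring
  rw [h1, h2, mul_le_mul_iff_right₀ hpos, mul_lt_mul_iff_right₀ hpos]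
end
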